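/- arXiv:2111.05774 — 3 statements merged into one kernel-verified Lean document; each statement's English description precedes it below -/
import Mathlib

section
/- Let K be a finite 2-dimensional simplicial complex and k ∈ ℕ. Then there exists a set F of 2-dimensional simplices of K with |F| ≤ k such that K ∖ F collapses to a complex of dimension at most 1, if and only if there exists a Morse matching on K with at most k critical 2-dimensional simplices. -/
variable {V : Type*} [DecidableEq V]

/-- `σ` is a facet (codimension-one face) of `τ`. -/
def Facet (σ τ : Finset V) : Prop := σ ⊆ τ ∧ τ.card = σ.card + 1

/-- A finite abstract simplicial complex: a finite family of nonempty finite sets,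
closed under taking nonempty subsets. -/
def IsComplex (K : Finset (Finset V)) : Prop :=
  (∀ σ ∈ K, σ.Nonempty) ∧ ∀ σ ∈ K, ∀ τ, τ ⊆ σ → τ.Nonempty → τ ∈ K

/-- A partial matching on the complex `K`: a set of pairs `(σ, τ)` with `σ ≺ τ`,
such that every simplex belongs to at most one pair. -/
def IsMatching (K : Finset (Finset V)) (M : Finset (Finset V × Finset V)) : Prop :=
  (∀ p ∈ M, p.1 ∈ K ∧ p.2 ∈ K ∧ Facet p.1 p.2) ∧
  ∀ p ∈ M, ∀ q ∈ M, (p.1 = q.1 ∨ p.1 = q.2 ∨ p.2 = q.1 ∨ p.2 = q.2) → p = q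

/-- Acyclicity of a matching: there is no cycle
`a₀ ≺ b₀ ≻ a₁ ≺ b₁ ≻ ⋯ ≺ b_{n-1} ≻ a₀` with `n ≥ 2`, all `(aᵢ, bᵢ) ∈ M`
and all `bᵢ` distinct. -/
def IsAcyclicMatching (M : Finset (Finset V × Finset V)) : Prop :=
  ¬ ∃ (n : ℕ) (a b : ℕ → Finset V), 2 ≤ n ∧
      (∀ i < n, ∀ j < n, b i = b j → i = j) ∧
      (∀ i < n, (a i, b i) ∈ M) ∧
      (∀ i < n, Facet (a ((i + 1) % n)) (b i))

/-- A Morse matching on `K` is an acyclic partial matching. -/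
def MorseMatching (K : Finset (Finset V)) (M : Finset (Finset V × Finset V)) : Prop :=
  IsMatching K M ∧ IsAcyclicMatching M

/-- A simplex is critical for `M` if it belongs to no pair of `M`. -/
def IsCritical (M : Finset (Finset V × Finset V)) (σ : Finset V) : Prop :=
  ∀ p ∈ M, σ ≠ p.1 ∧ σ ≠ p.2

/-- The number of critical simplices of dimension `i` (i.e. cardinality `i + 1`). -/
noncomputable def critCount (K : Finset (Finset V)) (M : Finset (Finset V × Finset V)) (i : ℕ) : ℕ :=
  {σ : Finset V | σ ∈ K ∧ σ.card = i + 1 ∧ IsCritical M σ}.ncard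

/-- The total number of critical simplices. -/
noncomputable def totalCrit (K : Finset (Finset V)) (M : Finset (Finset V × Finset V)) : ℕ :=
  {σ : Finset V | σ ∈ K ∧ IsCritical M σ}.ncard

/-- `σ` is a free face of `K` with unique proper coface `τ`. -/
def IsFreePair (K : Finset (Finset V)) (σ τ : Finset V) : Prop :=
  σ ∈ K ∧ τ ∈ K ∧ σ ⊂ τ ∧ ∀ ρ ∈ K, σ ⊂ ρ → ρ = τ

/-- An elementary collapse removes a free pair `{σ, τ}` from `K`. -/
def ElemCollapse (K K' : Finset (Finset V)) : Prop :=
  ∃ σ τ : Finset V, IsFreePair K σ τ ∧ K' = K \ {σ, τ}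

/-- `K` collapses to `L` via a finite sequence of elementary collapses. -/
def Collapses (K L : Finset (Finset V)) : Prop :=
  Relation.ReflTransGen ElemCollapse K L

/-- `K` is collapsible if it collapses to a single vertex. -/
def Collapsible (K : Finset (Finset V)) : Prop :=
  ∃ v : V, Collapses K {{v}}

/-- The 1-skeleton of `K` is a connected graph. -/
def SkeletonConnected (K : Finset (Finset V)) : Prop :=
  ∀ u v : V, ({u} : Finset V) ∈ K → ({v} : Finset V) ∈ K →
    Relation.ReflTransGen (fun a b => a ≠ b ∧ ({a, b} : Finset V) ∈ K) u v

/-- Removing the two members of a free pair from a complex leaves a complex. -/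
lemma IsComplex.sdiff_freePair {A : Finset (Finset V)} {σ τ : Finset V}
    (hA : IsComplex A) (h : IsFreePair A σ τ) : IsComplex (A \ {σ, τ}) := by
  obtain ⟨-, -, hστ, huniq⟩ := h
  refine ⟨fun ρ hρ => hA.1 ρ (Finset.mem_sdiff.1 hρ).1, fun ρ hρ π hπ hne => ?_⟩
  simp only [Finset.mem_sdiff, Finset.mem_insert, Finset.mem_singleton, not_or] at hρ ⊢
  obtain ⟨hρA, hρσ, hρτ⟩ := hρ
  refine ⟨hA.2 ρ hρA π hπ hne, ?_, ?_⟩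
  · rintro rfl
    exact hρτ (huniq ρ hρA (hπ.ssubset_of_ne (Ne.symm hρσ)))
  · rintro rfl
    exact hρτ (huniq ρ hρA (hστ.trans_subset hπ))

/-- Removing simplices of top dimension from a complex of dimension at most two leaves a complex. -/
lemma IsComplex.sdiff_triangles {K F : Finset (Finset V)} (hK : IsComplex K)
    (hdim : ∀ σ ∈ K, σ.card ≤ 3) (hF : ∀ σ ∈ F, σ.card = 3) : IsComplex (K \ F) := by
  refine ⟨fun ρ hρ => hK.1 ρ (Finset.mem_sdiff.1 hρ).1, fun ρ hρ π hπ hne => ?_⟩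
  obtain ⟨hρK, hρF⟩ := Finset.mem_sdiff.1 hρ
  refine Finset.mem_sdiff.2 ⟨hK.2 ρ hρK π hπ hne, fun hπF => hρF ?_⟩
  have hcard : ρ.card ≤ π.card := (hdim ρ hρK).trans (hF π hπF).ge
  rwa [← Finset.eq_of_subset_of_card_le hπ hcard]

/-- In a complex, the unique proper coface of a free face has codimension one. -/
lemma IsFreePair.facet {A : Finset (Finset V)} {σ τ : Finset V}
    (hA : IsComplex A) (h : IsFreePair A σ τ) : Facet σ τ := by
  obtain ⟨-, hτ, hστ, huniq⟩ := h
  refine ⟨hστ.subset, ?_⟩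
  obtain ⟨v, hvτ, hvσ⟩ := Finset.exists_of_ssubset hστ
  have hins : insert v σ ∈ A :=
    hA.2 τ hτ _ (Finset.insert_subset hvτ hστ.subset) (Finset.insert_nonempty v σ)
  rw [← huniq _ hins (Finset.ssubset_insert hvσ), Finset.card_insert_of_notMem hvσ]

/-- A facet of `τ` is a proper subset of `τ`. -/
lemma Facet.ssubset {W : Type*} {σ τ : Finset W} (h : Facet σ τ) : σ ⊂ τ := by
  refine h.1.ssubset_of_ne ?_
  rintro rfl
  have := h.2
  omega

/-- A Morse matching on the result of an elementary collapse extends by the collapsed pair. -/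
lemma MorseMatching.insert_freePair {A : Finset (Finset V)} {σ τ : Finset V}
    {M : Finset (Finset V × Finset V)} (hA : IsComplex A) (h : IsFreePair A σ τ)
    (hM : MorseMatching (A \ {σ, τ}) M) : MorseMatching A (insert (σ, τ) M) := by
  obtain ⟨⟨hpairs, hdisj⟩, hacyc⟩ := hM
  have hmem : ∀ p ∈ M, (p.1 ∈ A ∧ p.1 ≠ σ ∧ p.1 ≠ τ) ∧ (p.2 ∈ A ∧ p.2 ≠ σ ∧ p.2 ≠ τ) := by
    intro p hp
    simpa using And.intro (hpairs p hp).1 (hpairs p hp).2.1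
  have hne : σ ≠ τ := h.2.2.1.ne
  refine ⟨⟨?_, ?_⟩, ?_⟩
  · intro p hp
    rcases Finset.mem_insert.1 hp with rfl | hp
    · exact ⟨h.1, h.2.1, h.facet hA⟩
    · exact ⟨(hmem p hp).1.1, (hmem p hp).2.1, (hpairs p hp).2.2⟩
  · intro p hp q hq hpq
    rcases Finset.mem_insert.1 hp with rfl | hp <;> rcases Finset.mem_insert.1 hq with rfl | hq
    · rfl
    · have := hmem q hq
      grind
    · have := hmem p hp
      grind
    · exact hdisj p hp q hq hpq
  · rintro ⟨n, a, b, hn, hinj, hab, hfacet⟩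
    have hbA : ∀ i < n, b i ∈ A := by
      intro i hi
      rcases Finset.mem_insert.1 (hab i hi) with heq | hp
      · rw [show b i = τ from congrArg Prod.snd heq]
        exact h.2.1
      · exact (hmem _ hp).2.1
    refine hacyc ⟨n, a, b, hn, hinj, fun i hi => ?_, hfacet⟩
    refine (Finset.mem_insert.1 (hab i hi)).resolve_left fun heq => ?_
    obtain ⟨haσ, hbτ⟩ : a i = σ ∧ b i = τ := by simpa using heq
    obtain ⟨j, hj, hji, hjne⟩ : ∃ j < n, (j + 1) % n = i ∧ j ≠ i := by
      rcases Nat.eq_zero_or_pos i with rfl | hpos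
      · refine ⟨n - 1, by omega, ?_, by omega⟩
        rw [Nat.sub_add_cancel (by omega), Nat.mod_self]
      · refine ⟨i - 1, by omega, ?_, by omega⟩
        rw [Nat.sub_add_cancel hpos, Nat.mod_eq_of_lt hi]
    have hf := hfacet j hj
    rw [hji, haσ] at hf
    exact hjne (hinj j hj i hi ((h.2.2.2 _ (hbA j hj) hf.ssubset).trans hbτ.symm))

/-- A collapse from `A` to `B` gives a Morse matching on `A` whose critical simplices lie in `B`. -/
lemma Collapses.exists_morseMatching {A B : Finset (Finset V)} (h : Collapses A B)
    (hA : IsComplex A) :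
    ∃ M : Finset (Finset V × Finset V), MorseMatching A M ∧ ∀ σ ∈ A, IsCritical M σ → σ ∈ B := by
  induction h using Relation.ReflTransGen.head_induction_on with
  | refl =>
    refine ⟨∅, ⟨⟨by simp, by simp⟩, ?_⟩, fun σ hσ _ => hσ⟩
    rintro ⟨n, a, b, hn, -, hab, -⟩
    simpa using hab 0 (by omega)
  | head hstep _ ih =>
    obtain ⟨σ, τ, hfree, rfl⟩ := hstep
    obtain ⟨M, hM, hcrit⟩ := ih (hA.sdiff_freePair hfree)
    refine ⟨insert (σ, τ) M, hM.insert_freePair hA hfree, fun ρ hρ hρM => ?_⟩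
    have hne := hρM (σ, τ) (Finset.mem_insert_self _ _)
    exact hcrit ρ (by simp [hρ, hne.1, hne.2])
      fun p hp => hρM p (Finset.mem_insert_of_mem hp)

/-- A self-map without fixed points of a nonempty finite type has a periodic orbit of length at
least two. -/
lemma exists_two_le_minimalPeriod {T : Type*} [Finite T] [Nonempty T] (f : T → T)
    (hf : ∀ t, f t ≠ t) : ∃ t, 2 ≤ Function.minimalPeriod f t := by
  obtain ⟨x⟩ := ‹Nonempty T›
  obtain ⟨m, n, hmn, heq⟩ : ∃ m n, m < n ∧ f^[m] x = f^[n] x := by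
    obtain ⟨m, n, hmn, heq⟩ := Finite.exists_ne_map_eq_of_infinite fun n : ℕ => f^[n] x
    rcases hmn.lt_or_gt with hlt | hlt
    · exact ⟨m, n, hlt, heq⟩
    · exact ⟨n, m, hlt, heq.symm⟩
  have hper : Function.IsPeriodicPt f (n - m) (f^[m] x) := by
    rw [Function.IsPeriodicPt, Function.IsFixedPt, ← Function.iterate_add_apply,
      Nat.sub_add_cancel hmn.le, heq]
  refine ⟨f^[m] x, ?_⟩
  have hpos := hper.minimalPeriod_pos (by omega)
  have hone : Function.minimalPeriod f (f^[m] x) ≠ 1 := fun h =>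
    hf _ (Function.minimalPeriod_eq_one_iff_isFixedPt.1 h)
  omega

/-- If every triangle of a complex of dimension at most two is matched downwards by an acyclic
matching, then some triangle is matched with a free edge. -/
lemma exists_freePair_of_acyclic {A : Finset (Finset V)} {M : Finset (Finset V × Finset V)}
    (hA : IsComplex A) (hdim : ∀ σ ∈ A, σ.card ≤ 3) (hacyc : IsAcyclicMatching M)
    (hM : ∀ τ ∈ A, τ.card = 3 → ∃ σ, (σ, τ) ∈ M ∧ Facet σ τ) (htri : ∃ τ ∈ A, τ.card = 3) :
    ∃ σ τ, IsFreePair A σ τ ∧ τ.card = 3 := by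
  by_contra! hno
  let T := {τ // τ ∈ A.filter fun τ => τ.card = 3}
  have hT (t : T) : t.1 ∈ A ∧ t.1.card = 3 := Finset.mem_filter.1 t.2
  choose e heM hef using fun t : T => hM t.1 (hT t).1 (hT t).2
  have hnext : ∀ t : T, ∃ s : T, s ≠ t ∧ Facet (e t) s.1 := by
    intro t
    obtain ⟨htA, ht3⟩ := hT t
    have hcard := (hef t).2
    have heA : e t ∈ A := hA.2 _ htA _ (hef t).1 (Finset.card_pos.1 (by omega))
    by_contra! hs
    refine hno (e t) t.1 ⟨heA, htA, (hef t).ssubset, fun ρ hρ hlt => ?_⟩ ht3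
    by_contra hne
    have h1 := Finset.card_lt_card hlt
    have h2 := hdim ρ hρ
    refine hs ⟨ρ, Finset.mem_filter.2 ⟨hρ, by omega⟩⟩ (fun h => hne (congrArg Subtype.val h)) ?_
    exact ⟨hlt.subset, by dsimp only; omega⟩
  choose f hfne hff using hnext
  obtain ⟨τ, hτA, hτ3⟩ := htri
  have : Finite T := Finset.finite_toSet _
  have : Nonempty T := ⟨⟨τ, Finset.mem_filter.2 ⟨hτA, hτ3⟩⟩⟩
  obtain ⟨t, ht⟩ := exists_two_le_minimalPeriod f hfne
  set n := Function.minimalPeriod f t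
  have hper : f^[n] t = t := Function.iterate_minimalPeriod
  -- Traverse the orbit backwards, so that consecutive triangles match the required direction.
  refine hacyc ⟨n, fun i => e (f^[n - 1 - i] t), fun i => (f^[n - 1 - i] t).1, ht, ?_,
    fun i _ => heM _, ?_⟩
  · intro i hi j hj hij
    have := Function.iterate_injOn_Iio_minimalPeriod (f := f) (x := t)
      (show n - 1 - i < n by omega) (show n - 1 - j < n by omega) (Subtype.ext hij)
    omega
  · intro i hi
    rcases Nat.lt_or_ge (i + 1) n with hlt | hge
    · have hstep : f^[n - 1 - i] t = f (f^[n - 1 - (i + 1)] t) := by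
        rw [← Function.iterate_succ_apply' f]
        congr 2
        omega
      rw [Nat.mod_eq_of_lt hlt]
      beta_reduce
      rw [hstep]
      exact hff _
    · obtain rfl : i = n - 1 := by omega
      have hstep : f (f^[n - 1] t) = t := by
        rw [← Function.iterate_succ_apply' f, Nat.succ_eq_add_one,
          Nat.sub_add_cancel (by omega), hper]
      rw [Nat.sub_add_cancel (by omega), Nat.mod_self]
      simpa [hstep] using hff (f^[n - 1] t)

/-- If every triangle of a complex of dimension at most two is matched downwards by an acyclic
matching, then the complex collapses to a graph. -/
lemma exists_collapses_of_acyclic {M : Finset (Finset V × Finset V)}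
    (hacyc : IsAcyclicMatching M) (A : Finset (Finset V)) (hA : IsComplex A)
    (hdim : ∀ σ ∈ A, σ.card ≤ 3)
    (hM : ∀ τ ∈ A, τ.card = 3 → ∃ σ, (σ, τ) ∈ M ∧ Facet σ τ) :
    ∃ L : Finset (Finset V), Collapses A L ∧ ∀ σ ∈ L, σ.card ≤ 2 := by
  induction A using Finset.strongInduction with
  | H A ih =>
    by_cases htri : ∃ τ ∈ A, τ.card = 3
    · obtain ⟨σ, τ, hfree, -⟩ := exists_freePair_of_acyclic hA hdim hacyc hM htri
      have hsub : A \ {σ, τ} ⊂ A :=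
        Finset.sdiff_ssubset (by simp [Finset.insert_subset_iff, hfree.1, hfree.2.1]) (by simp)
      obtain ⟨L, hL, hL2⟩ := ih _ hsub (hA.sdiff_freePair hfree)
        (fun ρ hρ => hdim ρ (hsub.subset hρ)) (fun ρ hρ => hM ρ (hsub.subset hρ))
      exact ⟨L, Relation.ReflTransGen.head ⟨σ, τ, hfree, rfl⟩ hL, hL2⟩
    · push Not at htri
      refine ⟨A, Relation.ReflTransGen.refl, fun σ hσ => ?_⟩
      have h1 := hdim σ hσ
      have h2 := htri σ hσ
      omega

/-- For a finite 2-dimensional simplicial complex `K` and `k ∈ ℕ`: there is a set `F`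
of 2-simplices of `K` with `|F| ≤ k` such that `K ∖ F` collapses to a complex of
dimension at most 1, iff there is a Morse matching on `K` with at most `k` critical
2-dimensional simplices. -/
theorem erasable_after_removal_iff_morse_matching
    (K : Finset (Finset V)) (k : ℕ)
    (hK : IsComplex K) (hdim : ∀ σ ∈ K, σ.card ≤ 3) (hdim2 : ∃ σ ∈ K, σ.card = 3) :
    (∃ F ⊆ K, (∀ σ ∈ F, σ.card = 3) ∧ F.card ≤ k ∧
        ∃ L : Finset (Finset V), Collapses (K \ F) L ∧ ∀ σ ∈ L, σ.card ≤ 2) ↔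
      ∃ M : Finset (Finset V × Finset V), MorseMatching K M ∧ critCount K M 2 ≤ k := by
  constructor
  · rintro ⟨F, hFK, hF3, hFk, L, hL, hL2⟩
    obtain ⟨M, ⟨⟨hpairs, hdisj⟩, hacyc⟩, hcrit⟩ :=
      hL.exists_morseMatching (hK.sdiff_triangles hdim hF3)
    refine ⟨M, ⟨⟨fun p hp => ?_, hdisj⟩, hacyc⟩, le_trans ?_ hFk⟩
    · obtain ⟨h1, h2, h3⟩ := hpairs p hp
      exact ⟨(Finset.mem_sdiff.1 h1).1, (Finset.mem_sdiff.1 h2).1, h3⟩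
    · rw [critCount, ← Set.ncard_coe_finset F]
      refine Set.ncard_le_ncard ?_ F.finite_toSet
      rintro σ ⟨hσK, hσ3, hσM⟩
      by_contra hσF
      have := hL2 σ (hcrit σ (Finset.mem_sdiff.2 ⟨hσK, hσF⟩) hσM)
      omega
  · rintro ⟨M, ⟨⟨hpairs, -⟩, hacyc⟩, hcount⟩
    classical
    let F := K.filter fun σ => σ.card = 3 ∧ IsCritical M σ
    have hF3 : ∀ σ ∈ F, σ.card = 3 := fun σ hσ => (Finset.mem_filter.1 hσ).2.1
    refine ⟨F, Finset.filter_subset _ _, hF3, ?_, ?_⟩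
    · rw [critCount] at hcount
      rw [← Set.ncard_coe_finset F]
      convert hcount using 2
      ext σ
      simp [F]
    · refine exists_collapses_of_acyclic hacyc _ (hK.sdiff_triangles hdim hF3)
        (fun σ hσ => hdim σ (Finset.mem_sdiff.1 hσ).1) fun τ hτ hτ3 => ?_
      obtain ⟨hτK, hτF⟩ := Finset.mem_sdiff.1 hτ
      have hncrit : ¬ IsCritical M τ := fun hc => hτF (Finset.mem_filter.2 ⟨hτK, hτ3, hc⟩)
      rw [IsCritical] at hncrit
      push Not at hncrit
      obtain ⟨⟨σ, ρ⟩, hp, hτp⟩ := hncrit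
      obtain ⟨-, hρK, hfacet⟩ := hpairs _ hp
      obtain rfl : τ = ρ := by
        refine hτp ?_
        rintro rfl
        have h1 := hfacet.2
        have h2 := hdim _ hρK
        dsimp only at h1 h2 hτ3
        omega
      exact ⟨σ, hp, hfacet⟩
end

section
/- Let K be a finite connected simplicial complex with n simplices, p a vertex of K, c ≥ 1 an integer, and let K̂_c be the amplified complex, i.e., the wedge sum of n^{c−1} copies of K at the basepoint p. Then K̂_c is collapsible if and only if K is collapsible. -/
variable {V : Type*} [DecidableEq V]

/-- The vertex set of the wedge of `m` copies of a complex on `V` pointed at `p`: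
the basepoint `none = ⋆` together with `(V ∖ {p}) × {1,…,m}`. -/
abbrev WedgeVertex (V : Type*) (p : V) (m : ℕ) := Option ({ v : V // v ≠ p } × Fin m)

/-- The `i`-th injection `V → WedgeVertex V p m`, sending `p` to the basepoint and
any `v ≠ p` to `(v, i)`. -/
def wedgeMap (p : V) (m : ℕ) (i : Fin m) (v : V) : WedgeVertex V p m :=
  if h : v = p then none else some ⟨⟨v, h⟩, i⟩

/-- The wedge sum of `m` copies of the pointed complex `(K, p)`: the simplices are the
images of simplices of `K` under the `m` injections. -/
def wedge (K : Finset (Finset V)) (p : V) (m : ℕ) : Finset (Finset (WedgeVertex V p m)) :=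
  Finset.univ.biUnion fun i : Fin m => K.image fun σ => σ.image (wedgeMap p m i)

theorem IsComplex.collapse {K : Finset (Finset V)} (hK : IsComplex K) {σ τ : Finset V}
    (h : IsFreePair K σ τ) : IsComplex (K \ {σ, τ}) := by
  obtain ⟨-, -, hστ, huniq⟩ := h
  refine ⟨fun ρ hρ => hK.1 ρ (Finset.mem_sdiff.1 hρ).1, fun ρ hρ μ hμρ hμ => ?_⟩
  simp only [Finset.mem_sdiff, Finset.mem_insert, Finset.mem_singleton, not_or] at hρ ⊢
  refine ⟨hK.2 ρ hρ.1 μ hμρ hμ, ?_, ?_⟩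
  · rintro rfl
    exact hρ.2.2 (huniq ρ hρ.1 (hμρ.ssubset_of_ne (Ne.symm hρ.2.1)))
  · rintro rfl
    exact hρ.2.2 (huniq ρ hρ.1 (hστ.trans_subset hμρ))

/-- The face of `τ` complementary to the free face `σ` survives the collapse. -/
theorem IsFreePair.sdiff_mem {K : Finset (Finset V)} (hK : IsComplex K) {σ τ : Finset V}
    (h : IsFreePair K σ τ) : τ \ σ ∈ K \ {σ, τ} := by
  obtain ⟨hσ, hτ, hστ, -⟩ := h
  obtain ⟨x, hx⟩ := hK.1 σ hσ
  simp only [Finset.mem_sdiff, Finset.mem_insert, Finset.mem_singleton, not_or]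
  refine ⟨hK.2 τ hτ _ Finset.sdiff_subset (Finset.sdiff_nonempty.2 hστ.2), ?_, ?_⟩ <;>
    intro he
  · have := he ▸ hx
    simp [hx] at this
  · have := he ▸ hστ.1 hx
    simp [hx] at this

theorem Collapses.subset {A B : Finset (Finset V)} (h : Collapses A B) : B ⊆ A := by
  induction h with
  | refl => exact subset_rfl
  | tail _ hstep ih =>
    obtain ⟨σ, τ, -, rfl⟩ := hstep
    exact Finset.sdiff_subset.trans ih

/-- A collapse extends to a larger family if no removed simplex is a face of an added one. -/
theorem Collapses.union {A B : Finset (Finset V)} (h : Collapses A B) (D : Finset (Finset V))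
    (hAD : Disjoint A D) (hD : ∀ α ∈ A, α ∉ B → ∀ δ ∈ D, ¬ α ⊂ δ) :
    Collapses (A ∪ D) (B ∪ D) := by
  induction h using Relation.ReflTransGen.head_induction_on with
  | refl => exact Relation.ReflTransGen.refl
  | @head A A' hstep htail ih =>
    have hsub := Collapses.subset htail
    obtain ⟨σ, τ, ⟨hσ, hτ, hστ, huniq⟩, rfl⟩ := hstep
    have hσB : σ ∉ B := fun h => by simpa using hsub h
    refine Relation.ReflTransGen.head ⟨σ, τ, ⟨Finset.mem_union_left _ hσ,
      Finset.mem_union_left _ hτ, hστ, fun ρ hρ hσρ => ?_⟩, ?_⟩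
      (ih (hAD.mono_left Finset.sdiff_subset)
        fun α hα => hD α (Finset.sdiff_subset hα))
    · rcases Finset.mem_union.1 hρ with hρ | hρ
      · exact huniq ρ hρ hσρ
      · exact absurd hσρ (hD σ hσ hσB ρ hρ)
    · have hσD := Finset.disjoint_left.1 hAD hσ
      have hτD := Finset.disjoint_left.1 hAD hτ
      ext ρ
      simp only [Finset.mem_union, Finset.mem_sdiff, Finset.mem_insert, Finset.mem_singleton]
      grind

theorem Collapses.image {W : Type*} [DecidableEq W] {f : V → W} (hf : Function.Injective f)
    {A B : Finset (Finset V)} (h : Collapses A B) :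
    Collapses (A.image (Finset.image f)) (B.image (Finset.image f)) := by
  refine Relation.ReflTransGen.lift (Finset.image (Finset.image f)) ?_ _ _ h
  rintro A _ ⟨σ, τ, ⟨hσ, hτ, hστ, huniq⟩, rfl⟩
  refine ⟨σ.image f, τ.image f, ⟨Finset.mem_image_of_mem _ hσ, Finset.mem_image_of_mem _ hτ,
    (Finset.image_ssubset_image hf).2 hστ, fun ρ hρ hσρ => ?_⟩, ?_⟩
  · obtain ⟨ρ, hρA, rfl⟩ := Finset.mem_image.1 hρ
    rw [huniq ρ hρA ((Finset.image_ssubset_image hf).1 hσρ)]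
  · rw [Finset.image_sdiff _ _ (Finset.image_injective hf), Finset.image_insert,
      Finset.image_singleton]

/-- A collapsible complex collapses to each of its vertices. -/
theorem Collapsible.collapses_vertex {K : Finset (Finset V)} (hK : IsComplex K)
    (h : Collapsible K) {u : V} (hu : {u} ∈ K) : Collapses K {{u}} := by
  obtain ⟨v, h⟩ := h
  induction h using Relation.ReflTransGen.head_induction_on generalizing u with
  | refl =>
    obtain rfl : u = v := by simpa using hu
    exact Relation.ReflTransGen.refl
  | @head A A' hstep htail ih =>
    obtain ⟨σ, τ, hfree, rfl⟩ := hstep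
    have hK' := hK.collapse hfree
    by_cases huA : {u} ∈ A \ {σ, τ}
    · exact Relation.ReflTransGen.head ⟨σ, τ, hfree, rfl⟩ (ih hK' huA)
    have hmem := hfree.sdiff_mem hK
    obtain ⟨hσ, hτ, hστ, huniq⟩ := hfree
    have hσu : σ = {u} := by
      have : {u} = σ ∨ {u} = τ := by
        by_contra hne
        exact huA (by simpa [hu] using hne)
      rcases this with h | h
      · exact h.symm
      · exact absurd (h ▸ hστ) (by simpa using (hK.1 σ hσ).ne_empty)
    subst hσu
    obtain ⟨w, hw⟩ := Finset.sdiff_nonempty.2 hστ.2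
    obtain ⟨hwτ, hwu⟩ := Finset.mem_sdiff.1 hw
    have hwu : w ≠ u := by simpa using hwu
    have hτ_eq : {u, w} = τ := by
      refine huniq _ (hK.2 τ hτ _ ?_ (by simp)) ?_
      · exact Finset.insert_subset (hστ.1 (by simp)) (by simpa using hwτ)
      · refine ⟨by simp, fun h => hwu ?_⟩
        simpa using h (by simp : w ∈ ({u, w} : Finset V))
    subst hτ_eq
    have hwA : {w} ∈ A \ {{u}, {u, w}} :=
      hK'.2 _ hmem _ (by simpa using hwu) (by simp)
    have hcol := (ih hK' hwA).union {{u}, {u, w}} Finset.sdiff_disjoint ?_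
    · rw [Finset.sdiff_union_of_subset (by
        intro x hx
        simp only [Finset.mem_insert, Finset.mem_singleton] at hx
        rcases hx with rfl | rfl <;> assumption)] at hcol
      refine hcol.tail ⟨{w}, {u, w}, ⟨by simp, by simp, ?_, ?_⟩, ?_⟩
      · refine ⟨by simp, fun h => hwu ?_⟩
        simpa [eq_comm] using h (by simp : u ∈ ({u, w} : Finset V))
      · intro ρ hρ hwρ
        simp only [Finset.mem_union, Finset.mem_insert, Finset.mem_singleton] at hρ
        rcases hρ with rfl | rfl | rfl
        · exact absurd hwρ (ssubset_irrefl _)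
        · exact absurd (hwρ.1 (Finset.mem_singleton_self w)) (by simpa using hwu)
        · rfl
      · have h1 : ({u} : Finset V) ≠ {w} := by simpa using hwu.symm
        have h2 : ({u} : Finset V) ≠ {u, w} := hστ.ne
        ext ρ
        simp only [Finset.mem_union, Finset.mem_sdiff, Finset.mem_insert, Finset.mem_singleton]
        grind
    · intro α hα hαw δ hδ hαδ
      have hne := hK'.1 α hα
      simp only [Finset.mem_sdiff, Finset.mem_insert, Finset.mem_singleton, not_or] at hα hαw hδ
      rcases hδ with rfl | rfl
      · rw [Finset.ssubset_singleton_iff] at hαδ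
        exact hne.ne_empty hαδ
      · have hsub := hαδ.1
        rw [← Finset.coe_subset, Finset.coe_pair, Set.subset_pair_iff_eq] at hsub
        norm_cast at hsub
        rcases hsub with h | h | h | h
        · exact hne.ne_empty h
        · exact hα.2.1 h
        · exact hαw h
        · exact hα.2.2 h

section Wedge

variable {p : V} {m : ℕ}

theorem wedgeMap_injective (i : Fin m) : Function.Injective (wedgeMap p m i) := by
  intro u v h
  unfold wedgeMap at h
  split_ifs at h <;> simp_all

theorem image_wedgeMap_basepoint (i : Fin m) :
    ({p} : Finset V).image (wedgeMap p m i) = {none} := by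
  simp [wedgeMap]

theorem snd_eq_of_mem_image_wedgeMap {i : Fin m} {σ : Finset V}
    {y : {v : V // v ≠ p} × Fin m} (h : some y ∈ σ.image (wedgeMap p m i)) : y.2 = i := by
  obtain ⟨v, -, hv⟩ := Finset.mem_image.1 h
  unfold wedgeMap at hv
  split_ifs at hv
  simp only [Option.some.injEq] at hv
  rw [← hv]

theorem exists_some_mem {X : Type*} {s : Finset (Option X)} (hs : s.Nonempty)
    (h : s ≠ {none}) : ∃ y, some y ∈ s := by
  by_contra! hy
  refine h (Finset.eq_singleton_iff_nonempty_unique_mem.2 ⟨hs, fun x hx => ?_⟩)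
  cases x with
  | none => rfl
  | some y => exact absurd hx (hy y)

theorem mem_wedge {K : Finset (Finset V)} {σ : Finset (WedgeVertex V p m)} :
    σ ∈ wedge K p m ↔ ∃ i, ∃ ρ ∈ K, ρ.image (wedgeMap p m i) = σ := by
  simp [wedge]

theorem IsComplex.wedge {K : Finset (Finset V)} (hK : IsComplex K) :
    IsComplex (wedge K p m) := by
  constructor
  · intro σ hσ
    obtain ⟨i, ρ, hρ, rfl⟩ := mem_wedge.1 hσ
    exact (hK.1 ρ hρ).image _
  · intro σ hσ τ hτ hne
    obtain ⟨i, ρ, hρ, rfl⟩ := mem_wedge.1 hσ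
    obtain ⟨μ, hμ, rfl⟩ := Finset.subset_image_iff.1 hτ
    exact mem_wedge.2 ⟨i, μ, hK.2 ρ hρ μ hμ (Finset.image_nonempty.1 hne), rfl⟩

/-- A subcomplex of a wedge that collapses to a vertex and misses the basepoint lies in a single
copy. -/
theorem Collapses.exists_copy {K : Finset (Finset V)} {L : Finset (Finset (WedgeVertex V p m))}
    {v : WedgeVertex V p m} (h : Collapses L {{v}}) (hL : IsComplex L) (hLK : L ⊆ _root_.wedge K p m)
    (hp : {none} ∉ L) : ∃ j, ∀ ρ ∈ L, ∀ y, some y ∈ ρ → y.2 = j := by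
  induction h using Relation.ReflTransGen.head_induction_on with
  | refl =>
    cases v with
    | none => simp at hp
    | some y => exact ⟨y.2, by simp +contextual⟩
  | @head A A' hstep htail ih =>
    obtain ⟨σ, τ, hfree, rfl⟩ := hstep
    obtain ⟨j, hj⟩ := ih (hL.collapse hfree) (Finset.sdiff_subset.trans hLK)
      fun h => hp (Finset.sdiff_subset h)
    have hmem := hfree.sdiff_mem hL
    obtain ⟨y, hy⟩ := exists_some_mem (hL.1 _ (Finset.sdiff_subset hmem))
      fun h => hp (h ▸ Finset.sdiff_subset hmem)
    have hyj := hj _ hmem y hy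
    obtain ⟨k, τ', -, hτ'⟩ := mem_wedge.1 (hLK hfree.2.1)
    have hτj : ∀ z, some z ∈ τ → z.2 = j := fun z hz => by
      rw [← hyj, snd_eq_of_mem_image_wedgeMap (hτ' ▸ hz),
        snd_eq_of_mem_image_wedgeMap (hτ' ▸ Finset.sdiff_subset hy)]
    refine ⟨j, fun ρ hρ z hz => ?_⟩
    by_cases h : ρ = σ ∨ ρ = τ
    · rcases h with rfl | rfl
      · exact hτj z (hfree.2.2.1.1 hz)
      · exact hτj z hz
    · exact hj ρ (by simpa [hρ] using h) z hz

/-- The trace on each copy of a collapsible subcomplex of a wedge is empty or collapsible. -/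
theorem Collapses.trace_collapsible {K : Finset (Finset V)} (hK : IsComplex K)
    {L : Finset (Finset (WedgeVertex V p m))} {v : WedgeVertex V p m}
    (h : Collapses L {{v}}) (hL : IsComplex L) (hLK : L ⊆ _root_.wedge K p m) (i : Fin m)
    (hne : (K.filter fun σ => σ.image (wedgeMap p m i) ∈ L).Nonempty) :
    Collapsible (K.filter fun σ => σ.image (wedgeMap p m i) ∈ L) := by
  have hinj := wedgeMap_injective (p := p) i
  induction h using Relation.ReflTransGen.head_induction_on with
  | refl =>
    obtain ⟨σ, hσ⟩ := hne
    simp only [Finset.mem_filter, Finset.mem_singleton] at hσ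
    obtain ⟨x, rfl⟩ : ∃ x, σ = {x} := by
      rw [← Finset.card_eq_one, ← Finset.card_image_of_injective σ hinj, hσ.2,
        Finset.card_singleton]
    have heq : (K.filter fun ρ => ρ.image (wedgeMap p m i) ∈ ({{v}} : Finset (Finset _))) =
        {{x}} := by
      ext ρ
      simp only [Finset.mem_filter, Finset.mem_singleton]
      refine ⟨fun h => Finset.image_injective hinj (h.2.trans hσ.2.symm), ?_⟩
      rintro rfl
      exact hσ
    exact ⟨x, heq ▸ Relation.ReflTransGen.refl⟩
  | @head A A' hstep htail ih =>
    obtain ⟨σ, τ, hfree, rfl⟩ := hstep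
    have hA' := hL.collapse hfree
    have hsub : A \ {σ, τ} ⊆ _root_.wedge K p m := Finset.sdiff_subset.trans hLK
    have hmem := hfree.sdiff_mem hL
    have ih := ih hA' hsub
    obtain ⟨k, τ', hτ'K, hτ'⟩ := mem_wedge.1 (hLK hfree.2.1)
    have hσne := hL.1 σ hfree.1
    have hτne := hL.1 τ hfree.2.1
    have hτstar : τ ≠ {none} := fun h =>
      hσne.ne_empty (Finset.ssubset_singleton_iff.1 (h ▸ hfree.2.2.1))
    by_cases hki : k = i
    · subst hki
      obtain ⟨σ', hσ'τ', hσ'⟩ := Finset.subset_image_iff.1 (hτ' ▸ hfree.2.2.1.1)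
      obtain ⟨μ', hμ'τ', hμ'⟩ := Finset.subset_image_iff.1
        (hτ'.symm ▸ Finset.sdiff_subset : τ \ σ ⊆ τ'.image (wedgeMap p m k))
      have hσ'K := hK.2 τ' hτ'K σ' hσ'τ' (Finset.image_nonempty.1 (hσ' ▸ hσne))
      have hμ'K := hK.2 τ' hτ'K μ' hμ'τ'
        (Finset.image_nonempty.1 (hμ' ▸ hA'.1 _ hmem))
      obtain ⟨w, hw⟩ := ih ⟨μ', Finset.mem_filter.2 ⟨hμ'K, hμ' ▸ hmem⟩⟩
      refine ⟨w, Relation.ReflTransGen.head ⟨σ', τ', ⟨?_, ?_, ?_, ?_⟩, ?_⟩ hw⟩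
      · exact Finset.mem_filter.2 ⟨hσ'K, hσ' ▸ hfree.1⟩
      · exact Finset.mem_filter.2 ⟨hτ'K, hτ' ▸ hfree.2.1⟩
      · rw [← Finset.image_ssubset_image hinj, hσ', hτ']
        exact hfree.2.2.1
      · intro ρ hρ hσρ
        refine Finset.image_injective hinj ((hfree.2.2.2 _ (Finset.mem_filter.1 hρ).2 ?_).trans
          hτ'.symm)
        rw [← hσ']
        exact (Finset.image_ssubset_image hinj).2 hσρ
      · ext ρ
        simp only [Finset.mem_filter, Finset.mem_sdiff, Finset.mem_insert, Finset.mem_singleton,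
          ← hσ', ← hτ', (Finset.image_injective hinj).eq_iff, and_assoc]
    have hcopy : ∀ s : Finset (WedgeVertex V p m), s.Nonempty → s ≠ {none} → s ⊆ τ →
        ∀ ρ : Finset V, ρ.image (wedgeMap p m i) ≠ s := by
      rintro s hs hs' hsτ ρ rfl
      obtain ⟨y, hy⟩ := exists_some_mem hs hs'
      exact hki ((snd_eq_of_mem_image_wedgeMap (hτ' ▸ hsτ hy)).symm.trans
        (snd_eq_of_mem_image_wedgeMap hy))
    by_cases hσstar : σ = {none}
    · by_cases hne' : (K.filter fun ρ => ρ.image (wedgeMap p m i) ∈ A \ {σ, τ}).Nonempty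
      · exfalso
        obtain ⟨ρ, hρ⟩ := hne'
        have hρ := (Finset.mem_filter.1 hρ).2
        have hstar : {none} ∉ A \ {σ, τ} := by simp [hσstar]
        obtain ⟨j, hj⟩ := Collapses.exists_copy htail hA' hsub hstar
        obtain ⟨y, hy⟩ := exists_some_mem (hA'.1 _ hρ) fun h => hstar (h ▸ hρ)
        obtain ⟨z, hz⟩ := exists_some_mem (hA'.1 _ hmem) fun h => hstar (h ▸ hmem)
        refine hki ?_
        rw [← snd_eq_of_mem_image_wedgeMap hy, hj _ hρ y hy, ← hj _ hmem z hz]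
        exact (snd_eq_of_mem_image_wedgeMap (hτ' ▸ Finset.sdiff_subset hz)).symm
      · suffices heq : (K.filter fun ρ => ρ.image (wedgeMap p m i) ∈ A) = {{p}} from
          ⟨p, heq ▸ Relation.ReflTransGen.refl⟩
        refine Finset.eq_singleton_iff_nonempty_unique_mem.2 ⟨hne, fun ρ hρ => ?_⟩
        rw [Finset.not_nonempty_iff_eq_empty, Finset.filter_eq_empty_iff] at hne'
        obtain ⟨hρK, hρA⟩ := Finset.mem_filter.1 hρ
        have := hne' hρK
        have hρτ := hcopy τ hτne hτstar subset_rfl ρ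
        have hρσ : ρ.image (wedgeMap p m i) = σ := by
          by_contra h
          exact this (by simp [hρA, h, hρτ])
        exact Finset.image_injective hinj
          (hρσ.trans (hσstar.trans (image_wedgeMap_basepoint i).symm))
    · have heq : (K.filter fun ρ => ρ.image (wedgeMap p m i) ∈ A \ {σ, τ}) =
          K.filter fun ρ => ρ.image (wedgeMap p m i) ∈ A :=
        Finset.filter_congr fun ρ _ => by
          simp [hcopy τ hτne hτstar subset_rfl ρ, hcopy σ hσne hσstar hfree.2.2.1.1 ρ]
      rw [heq] at ih
      exact ih hne

theorem Collapsible.of_wedge {K : Finset (Finset V)} (hK : IsComplex K)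
    (hp : ({p} : Finset V) ∈ K) (hm : 0 < m) (h : Collapsible (_root_.wedge K p m)) :
    Collapsible K := by
  obtain ⟨v, hv⟩ := h
  have heq : (K.filter fun σ => σ.image (wedgeMap p m ⟨0, hm⟩) ∈ _root_.wedge K p m) = K :=
    Finset.filter_true_of_mem fun σ hσ => mem_wedge.2 ⟨_, σ, hσ, rfl⟩
  have := hv.trace_collapsible hK hK.wedge subset_rfl ⟨0, hm⟩
  rw [heq] at this
  exact this ⟨_, hp⟩

theorem Collapsible.wedge {K : Finset (Finset V)} (hK : IsComplex K)
    (hp : ({p} : Finset V) ∈ K) (hm : 0 < m) (h : Collapsible K) :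
    Collapsible (wedge K p m) := by
  have hKp := h.collapses_vertex hK hp
  let C (i : Fin m) := K.image (Finset.image (wedgeMap p m i))
  have hC (i : Fin m) : Collapses (C i) {{none}} := by
    have hcol := hKp.image (wedgeMap_injective (p := p) i)
    rwa [Finset.image_singleton, image_wedgeMap_basepoint] at hcol
  have hstar (i : Fin m) : {none} ∈ C i := (hC i).subset (by simp)
  have key (S : Finset (Fin m)) : Collapses (insert {none} (S.biUnion C)) {{none}} := by
    induction S using Finset.induction_on with
    | empty => exact Relation.ReflTransGen.refl
    | @insert i S hi ih =>
      have hcol := (hC i).union (S.biUnion C \ C i) Finset.disjoint_sdiff ?_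
      · have hunion : C i ∪ S.biUnion C \ C i = insert {none} ((insert i S).biUnion C) := by
          rw [Finset.union_sdiff_self_eq_union, Finset.biUnion_insert,
            Finset.insert_eq_of_mem (Finset.mem_union_left _ (hstar i))]
        have hrest : {{none}} ∪ S.biUnion C \ C i = insert {none} (S.biUnion C) := by
          ext ρ
          simp only [Finset.mem_union, Finset.mem_insert, Finset.mem_singleton, Finset.mem_sdiff]
          refine or_congr_right' fun hρ => and_iff_left_of_imp fun hρS hρi => ?_
          obtain ⟨j, hj, hρj⟩ := Finset.mem_biUnion.1 hρS
          obtain ⟨δ, -, rfl⟩ := Finset.mem_image.1 hρj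
          obtain ⟨α, hαK, hα⟩ := Finset.mem_image.1 hρi
          obtain ⟨y, hy⟩ := exists_some_mem (hα ▸ (hK.1 α hαK).image _) hρ
          rw [← snd_eq_of_mem_image_wedgeMap (hα.symm ▸ hy : some y ∈ α.image (wedgeMap p m i)),
            snd_eq_of_mem_image_wedgeMap hy] at hi
          exact hi hj
        rw [hunion, hrest] at hcol
        exact hcol.trans ih
      · intro α hα hα' δ hδ hαδ
        obtain ⟨j, hj, hδj⟩ := Finset.mem_biUnion.1 (Finset.mem_sdiff.1 hδ).1
        obtain ⟨δ, -, rfl⟩ := Finset.mem_image.1 hδj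
        obtain ⟨α, hαK, rfl⟩ := Finset.mem_image.1 hα
        obtain ⟨y, hy⟩ := exists_some_mem ((hK.1 α hαK).image _) (by simpa using hα')
        have hij := (snd_eq_of_mem_image_wedgeMap hy).symm.trans
          (snd_eq_of_mem_image_wedgeMap (hαδ.1 hy))
        rw [hij] at hi
        exact hi hj
  refine ⟨none, ?_⟩
  have := key Finset.univ
  rwa [Finset.insert_eq_of_mem
    (Finset.mem_biUnion.2 ⟨⟨0, hm⟩, Finset.mem_univ _, hstar _⟩)] at this

end Wedge

/-- Let `K` be a finite connected simplicial complex with `n` simplices, `p` a vertex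
of `K` and `c ≥ 1`. The amplified complex `K̂_c` (the wedge of `n^(c−1)` copies of `K`
at `p`) is collapsible if and only if `K` is collapsible. -/
theorem amplified_collapsible_iff
    (K : Finset (Finset V)) (p : V) (c : ℕ)
    (hK : IsComplex K) (hconn : SkeletonConnected K) (hp : ({p} : Finset V) ∈ K)
    (hc : 1 ≤ c) :
    Collapsible (wedge K p (K.card ^ (c - 1))) ↔ Collapsible K := by
  have hm : 0 < K.card ^ (c - 1) := Nat.pow_pos (Finset.card_pos.2 ⟨_, hp⟩)
  exact ⟨Collapsible.of_wedge hK hp hm, Collapsible.wedge hK hp hm⟩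
end

section
/- Let K be a finite simplicial complex and M a partial matching on K. Let H_M be the directed graph whose vertices are the simplices of K, with a directed edge from σ to τ whenever (σ,τ) ∈ M, and a directed edge from τ to σ whenever σ ≺ τ and (σ,τ) ∉ M. Then every directed cycle in H_M has length at least 6, i.e., it contains at least 3 edges coming from pairs of M and at least 3 edges going from a simplex to one of its facets. -/
variable {V : Type*} [DecidableEq V]

/-- The edges of the modified Hasse diagram `H_M`: a directed edge from `σ` to `τ`
whenever `(σ, τ) ∈ M`, and a directed edge from `τ` to `σ` whenever `σ ≺ τ` and
`(σ, τ) ∉ M`. -/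
def HasseEdge (K : Finset (Finset V)) (M : Finset (Finset V × Finset V))
    (σ τ : Finset V) : Prop :=
  σ ∈ K ∧ τ ∈ K ∧ ((σ, τ) ∈ M ∨ (Facet τ σ ∧ (τ, σ) ∉ M))

/-- Two distinct simplices have at most one common simplex of which both are facets. -/
theorem Facet.eq_of_common {a a' b b' : Finset V} (hab : Facet a b) (hab' : Facet a' b)
    (hba : Facet a b') (hba' : Facet a' b') (hne : a ≠ a') : b = b' := by
  have union_eq : ∀ c : Finset V, Facet a c → Facet a' c → a ∪ a' = c := by
    intro c h h'
    refine Finset.eq_of_subset_of_card_le (Finset.union_subset h.1 h'.1) ?_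
    by_contra! hlt
    have hcard : a'.card = a.card := by have := h.2; have := h'.2; omega
    have heq : a = a ∪ a' :=
      Finset.eq_of_subset_of_card_le Finset.subset_union_left (by have := h.2; omega)
    have hsub : a' ⊆ a := heq ▸ Finset.subset_union_right
    exact hne (Finset.eq_of_subset_of_card_le hsub hcard.ge).symm
  exact (union_eq b hab hab').symm.trans (union_eq b' hba hba')

section

variable {K : Finset (Finset V)} {M : Finset (Finset V × Finset V)}

theorem HasseEdge.facet_of_notMem {σ τ : Finset V} (h : HasseEdge K M σ τ) (hmem : (σ, τ) ∉ M) :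
    Facet τ σ ∧ (τ, σ) ∉ M :=
  h.2.2.resolve_left hmem

theorem IsMatching.facet (hM : IsMatching K M) {σ τ : Finset V} (h : (σ, τ) ∈ M) : Facet σ τ :=
  (hM.1 _ h).2.2

/-- A directed walk in the modified Hasse diagram never goes up twice in a row. -/
theorem IsMatching.notMem_of_mem (hM : IsMatching K M) {σ τ ρ : Finset V} (h : (σ, τ) ∈ M) :
    (τ, ρ) ∉ M := by
  intro h'
  have heq := congrArg Prod.fst (hM.2 _ h _ h' (Or.inr (Or.inr (Or.inl rfl))))
  have hcard := (hM.facet h).2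
  simp only at heq
  rw [heq] at hcard
  omega

theorem IsMatching.not_hasseEdge_two_cycle (hM : IsMatching K M) {x y : Finset V}
    (h₁ : HasseEdge K M x y) (h₂ : HasseEdge K M y x) : False := by
  by_cases hxy : (x, y) ∈ M
  · exact (h₂.facet_of_notMem (hM.notMem_of_mem hxy)).2 hxy
  · obtain ⟨hf, hyx⟩ := h₁.facet_of_notMem hxy
    have := (h₂.facet_of_notMem hyx).1.2
    have := hf.2
    omega

/-- An up-edge is not the first edge of a directed 4-cycle. -/
theorem IsMatching.notMem_of_hasseEdge_four_cycle (hM : IsMatching K M) {x y z w : Finset V}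
    (h₂ : HasseEdge K M y z) (h₃ : HasseEdge K M z w) (h₄ : HasseEdge K M w x)
    (hxz : x ≠ z) (hyw : y ≠ w) : (x, y) ∉ M := by
  intro hxy
  have hyz := (h₂.facet_of_notMem (hM.notMem_of_mem hxy)).1
  have hwx : (w, x) ∉ M := fun h => hM.notMem_of_mem h hxy
  have hxw := (h₄.facet_of_notMem hwx).1
  by_cases hzw : (z, w) ∈ M
  · exact hyw ((hM.facet hxy).eq_of_common hyz hxw (hM.facet hzw) hxz)
  · have := (h₃.facet_of_notMem hzw).1.2
    have := (hM.facet hxy).2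
    have := hyz.2
    have := hxw.2
    omega

theorem IsMatching.not_hasseEdge_four_cycle (hM : IsMatching K M) {x y z w : Finset V}
    (h₁ : HasseEdge K M x y) (h₂ : HasseEdge K M y z) (h₃ : HasseEdge K M z w)
    (h₄ : HasseEdge K M w x) (hxz : x ≠ z) (hyw : y ≠ w) : False := by
  have d₁ := h₁.facet_of_notMem (hM.notMem_of_hasseEdge_four_cycle h₂ h₃ h₄ hxz hyw)
  have d₂ := h₂.facet_of_notMem (hM.notMem_of_hasseEdge_four_cycle h₃ h₄ h₁ hyw hxz.symm)
  have d₃ := h₃.facet_of_notMem (hM.notMem_of_hasseEdge_four_cycle h₄ h₁ h₂ hxz.symm hyw.symm)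
  have d₄ := h₄.facet_of_notMem (hM.notMem_of_hasseEdge_four_cycle h₁ h₂ h₃ hyw.symm hxz)
  have := d₁.1.2
  have := d₂.1.2
  have := d₃.1.2
  have := d₄.1.2
  omega

/-- The cardinality of the simplices along a directed walk rises at each up-edge and drops at
each down-edge. -/
theorem IsMatching.card_add_card_filter_eq (hM : IsMatching K M) (cyc : ℕ → Finset V) (n : ℕ)
    (hedges : ∀ i < n, HasseEdge K M (cyc i) (cyc (i + 1))) :
    (cyc n).card + ((Finset.range n).filter fun i => (cyc i, cyc (i + 1)) ∉ M).card =
      (cyc 0).card + ((Finset.range n).filter fun i => (cyc i, cyc (i + 1)) ∈ M).card := by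
  induction n with
  | zero => simp
  | succ n ih =>
    have ih := ih fun i hi => hedges i (by omega)
    by_cases h : (cyc n, cyc (n + 1)) ∈ M
    · have := (hM.facet h).2
      simp [Finset.range_add_one, Finset.filter_insert, h]
      omega
    · have := ((hedges n (by omega)).facet_of_notMem h).1.2
      simp [Finset.range_add_one, Finset.filter_insert, h]
      omega

end

/-- Every directed cycle in the modified Hasse diagram `H_M` of a partial matching `M`
on `K` has length at least 6: it contains at least 3 edges coming from pairs of `M`
(up-edges) and at least 3 edges going from a simplex to one of its facets
(down-edges). -/
theorem directed_cycle_length_ge_six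
    (K : Finset (Finset V)) (M : Finset (Finset V × Finset V))
    (hK : IsComplex K) (hM : IsMatching K M)
    (n : ℕ) (cyc : ℕ → Finset V) (hn : 1 ≤ n)
    (hedges : ∀ i < n, HasseEdge K M (cyc i) (cyc (i + 1)))
    (hclosed : cyc n = cyc 0)
    (hinj : ∀ i < n, ∀ j < n, cyc i = cyc j → i = j) :
    6 ≤ n ∧
      3 ≤ {i : ℕ | i < n ∧ (cyc i, cyc (i + 1)) ∈ M}.ncard ∧
      3 ≤ {i : ℕ | i < n ∧ Facet (cyc (i + 1)) (cyc i) ∧ (cyc (i + 1), cyc i) ∉ M}.ncard := by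
  have hup : {i : ℕ | i < n ∧ (cyc i, cyc (i + 1)) ∈ M} =
      ((Finset.range n).filter fun i => (cyc i, cyc (i + 1)) ∈ M : Finset ℕ) := by
    ext i
    simp
  have hdown : {i : ℕ | i < n ∧ Facet (cyc (i + 1)) (cyc i) ∧ (cyc (i + 1), cyc i) ∉ M} =
      ((Finset.range n).filter fun i => (cyc i, cyc (i + 1)) ∉ M : Finset ℕ) := by
    ext i
    simp only [Set.mem_ofPred_eq, Finset.coe_filter, Finset.mem_range]
    refine and_congr_right fun hi => ⟨fun h hmem => ?_, (hedges i hi).facet_of_notMem⟩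
    have := h.1.2
    have := (hM.facet hmem).2
    omega
  rw [hup, hdown, Set.ncard_coe_finset, Set.ncard_coe_finset]
  have hbalance := hM.card_add_card_filter_eq cyc n hedges
  have hsum := Finset.card_filter_add_card_filter_not (s := Finset.range n)
    fun i => (cyc i, cyc (i + 1)) ∈ M
  rw [hclosed] at hbalance
  rw [Finset.card_range] at hsum
  have hn2 : n ≠ 2 := by
    rintro rfl
    have h₂ := hedges 1 (by omega)
    rw [hclosed] at h₂
    exact hM.not_hasseEdge_two_cycle (hedges 0 (by omega)) h₂
  have hn4 : n ≠ 4 := by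
    rintro rfl
    have h₄ := hedges 3 (by omega)
    rw [hclosed] at h₄
    exact hM.not_hasseEdge_four_cycle (hedges 0 (by omega)) (hedges 1 (by omega))
      (hedges 2 (by omega)) h₄
      (fun h => absurd (hinj 0 (by omega) 2 (by omega) h) (by omega))
      (fun h => absurd (hinj 1 (by omega) 3 (by omega) h) (by omega))
  omega
end
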